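/- arXiv:1605.03998 — 8 statements merged into one kernel-verified Lean document; each statement's English description precedes it below -/
import Mathlib

section
/- Let (v̂_k)_{k ≥ 0} be the sequence of functions on [0,1] determined by v̂_0(s) = 0 for all s ∈ [0,1] and the recursion v̂_k(s) = (1 − ĥ_k(s) + s) v̂_{k-1}(s) + ∫_s^{ĥ_k(s)} (1 + v̂_{k-1}(x)) dx for k ≥ 1, where ĥ_k(s) = min{ s + (2(1-s)/k)^{1/2}, 1 }. Then for all k ≥ 1 and all s ∈ [0,1], v̂_k(s) ≥ (2k(1-s))^{1/2} − 2(log k + 1). -/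
open MeasureTheory intervalIntegral

/-- The adaptive threshold `ĥ_k(s) = min{ s + (2(1-s)/k)^{1/2}, 1 }`. -/
noncomputable def hhat (k : ℕ) (s : ℝ) : ℝ :=
  min (s + Real.sqrt (2 * (1 - s) / k)) 1

theorem continuous_hhat (k : ℕ) : Continuous (hhat k) := by
  unfold hhat
  fun_prop

theorem le_hhat (k : ℕ) {s : ℝ} (hs : s ≤ 1) : s ≤ hhat k s :=
  le_min (le_add_of_nonneg_right (Real.sqrt_nonneg _)) hs

theorem hhat_le_one (k : ℕ) (s : ℝ) : hhat k s ≤ 1 := min_le_right _ _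

theorem hhat_mem_Icc (k : ℕ) {s : ℝ} (hs : s ∈ Set.Icc (0 : ℝ) 1) :
    hhat k s ∈ Set.Icc (0 : ℝ) 1 :=
  ⟨hs.1.trans (le_hhat k hs.2), hhat_le_one k s⟩

/-- The value functions are continuous on the unit interval. -/
theorem continuousOn_value (v : ℕ → ℝ → ℝ)
    (hv0 : ∀ s ∈ Set.Icc (0:ℝ) 1, v 0 s = 0)
    (hv : ∀ k : ℕ, 1 ≤ k → ∀ s ∈ Set.Icc (0:ℝ) 1,
      v k s = (1 - hhat k s + s) * v (k-1) s + ∫ x in s..(hhat k s), (1 + v (k-1) x))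
    (k : ℕ) : ContinuousOn (v k) (Set.Icc 0 1) := by
  induction k with
  | zero => exact continuousOn_const.congr hv0
  | succ k ih =>
    have hg : ContinuousOn (fun x => 1 + v k x) (Set.Icc 0 1) := continuousOn_const.add ih
    have hint : ∀ t ∈ Set.Icc (0:ℝ) 1,
        IntervalIntegrable (fun x => 1 + v k x) volume 0 t := fun t ht =>
      (hg.mono (by rw [Set.uIcc_of_le ht.1]; exact Set.Icc_subset_Icc_right ht.2)).intervalIntegrable
    have hF : ContinuousOn (fun t => ∫ x in (0:ℝ)..t, (1 + v k x)) (Set.Icc 0 1) := by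
      have := intervalIntegral.continuousOn_primitive_interval
        (μ := volume) (f := fun x => 1 + v k x) (a := 0) (b := 1)
        (by rw [Set.uIcc_of_le zero_le_one]; exact hg.integrableOn_Icc)
      rwa [Set.uIcc_of_le zero_le_one] at this
    have hh := (continuous_hhat (k + 1)).continuousOn (s := Set.Icc 0 1)
    have hFh := hF.comp hh (fun s hs => hhat_mem_Icc (k + 1) hs)
    refine (((((continuousOn_const (c := (1:ℝ))).sub hh).add continuousOn_id).mul ih).add
      (hFh.sub hF)).congr fun s hs => ?_
    rw [hv (k + 1) (Nat.le_add_left 1 k) s hs, Nat.add_sub_cancel,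
      ← intervalIntegral.integral_interval_sub_left (hint _ (hhat_mem_Icc (k + 1) hs)) (hint s hs)]
    rfl

/-- A quadratic lower bound for the square root, to the left of `Y ^ 2`. -/
theorem quadratic_le_sqrt {Y t : ℝ} (hY : 0 < Y) (ht : 0 ≤ t) (htY : t ≤ Y ^ 2) :
    Y - t / (2 * Y) - t ^ 2 / (2 * Y ^ 3) ≤ Real.sqrt (Y ^ 2 - t) := by
  obtain ⟨x, rfl⟩ : ∃ x, t = Y ^ 2 * x := ⟨t / Y ^ 2, by field_simp⟩
  have hx : 0 ≤ x := nonneg_of_mul_nonneg_right ht (by positivity)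
  have hx1 : x ≤ 1 := by
    by_contra! h
    nlinarith [mul_lt_mul_of_pos_left h (by positivity : 0 < Y ^ 2)]
  have hpoly : Y - Y ^ 2 * x / (2 * Y) - (Y ^ 2 * x) ^ 2 / (2 * Y ^ 3) =
      Y * ((1 - x) * (1 + x / 2)) := by
    field_simp
    ring
  rw [hpoly]
  refine Real.le_sqrt_of_sq_le ?_
  have h : (1 - x) * ((1 - x) * (1 + x / 2) ^ 2) ≤ (1 - x) * 1 := by
    refine mul_le_mul_of_nonneg_left ?_ (by linarith)
    nlinarith [mul_nonneg hx hx, mul_nonneg hx (mul_nonneg hx hx)]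
  nlinarith [mul_le_mul_of_nonneg_left h (sq_nonneg Y)]

/-- The one-step loss of the quadratic lower bound, where `a = √(2(k-1))`, `b = √(2k)`,
`Y = √(1-s)`. -/
theorem step_loss_le {a b Y : ℝ} (ha : 0 ≤ a) (hb : 0 < b) (hab : a ^ 2 = b ^ 2 - 2)
    (hY : 0 < Y) :
    b * Y - a * Y - min (2 * Y / b) (Y ^ 2) + a * min (2 * Y / b) (Y ^ 2) ^ 2 / (4 * Y)
      + a * min (2 * Y / b) (Y ^ 2) ^ 3 / (6 * Y ^ 3) ≤ 4 / b ^ 2 := by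
  have hle : a ≤ b := by nlinarith
  rcases le_total (2 * Y / b) (Y ^ 2) with h | h
  · rw [min_eq_left h]
    have h1 : b * Y - a * Y - 2 * Y / b + a * (2 * Y / b) ^ 2 / (4 * Y)
        + a * (2 * Y / b) ^ 3 / (6 * Y ^ 3) =
        (Y * (b * (b ^ 2 - 2) - a * b ^ 2 + a) + 4 / 3 * (a / b)) / b ^ 2 := by
      field_simp
      ring
    rw [h1]
    gcongr
    have h2 : a / b ≤ 1 := (div_le_one hb).2 hle
    have h3 : b * (b ^ 2 - 2) - a * b ^ 2 + a ≤ 0 := by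
      rw [← hab]
      have : a * (a * b - b ^ 2 + 1) ≤ 0 :=
        mul_nonpos_of_nonneg_of_nonpos ha (by nlinarith [sq_nonneg (a - b)])
      linarith
    nlinarith [mul_nonneg hY.le (neg_nonneg.2 h3)]
  · rw [min_eq_right h]
    have hYb : Y ≤ 2 / b := by
      rw [le_div_iff₀ hb]
      rw [le_div_iff₀ hb] at h
      nlinarith
    have h1 : b * Y - a * Y - Y ^ 2 + a * (Y ^ 2) ^ 2 / (4 * Y) + a * (Y ^ 2) ^ 3 / (6 * Y ^ 3) =
        (b - a) * Y - Y ^ 2 * (1 - 5 / 12 * (a * Y)) := by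
      field_simp
      ring
    have h2 : b - a ≤ 2 / b := by
      rw [le_div_iff₀ hb]
      nlinarith
    have h3 : a * Y ≤ 2 := by
      have := mul_le_mul hle hYb hY.le hb.le
      rwa [mul_div_cancel₀ _ hb.ne'] at this
    have h4 : (b - a) * Y ≤ 2 / b * (2 / b) := mul_le_mul h2 hYb hY.le (by positivity)
    have h5 : 0 ≤ Y ^ 2 * (1 - 5 / 12 * (a * Y)) := mul_nonneg (sq_nonneg Y) (by linarith)
    have h6 : 2 / b * (2 / b) = 4 / b ^ 2 := by
      field_simp
      norm_num
    linarith

/-- The increment of the threshold in terms of square roots. -/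
theorem hhat_sub_self {k : ℕ} {s : ℝ} (hk : 1 ≤ k) (hs : s ≤ 1) :
    hhat k s - s = min (2 * √(1 - s) / √(2 * k)) (√(1 - s) ^ 2) := by
  have hk' : (0:ℝ) < k := by exact_mod_cast hk
  have h : √(2 * (1 - s) / k) = 2 * √(1 - s) / √(2 * k) := by
    rw [show 2 * (1 - s) / (k:ℝ) = 2 ^ 2 * (1 - s) / (2 * k) by field_simp,
      Real.sqrt_div (by nlinarith), Real.sqrt_mul (by norm_num), Real.sqrt_sq (by norm_num)]
  rw [hhat, h, Real.sq_sqrt (by linarith), ← min_sub_sub_right, add_sub_cancel_left]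

theorem integral_quadratic (c p q s h : ℝ) :
    ∫ x in s..h, (c - p * (x - s) - q * (x - s) ^ 2) =
      c * (h - s) - p * (h - s) ^ 2 / 2 - q * (h - s) ^ 3 / 3 := by
  rw [intervalIntegral.integral_comp_sub_right (fun x => c - p * x - q * x ^ 2) s,
    intervalIntegral.integral_sub, intervalIntegral.integral_sub,
    intervalIntegral.integral_const, intervalIntegral.integral_const_mul,
    intervalIntegral.integral_const_mul, integral_id, integral_pow]
  · simp only [smul_eq_mul]
    norm_num
    ring
  all_goals exact Continuous.intervalIntegrable (by fun_prop) _ _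

/-- A lower bound `√(2k(1-s)) - r` loses at most `2/(k+1)` under one step of the recursion. -/
theorem recursion_lower_bound {w : ℝ → ℝ} {k : ℕ} {r s : ℝ}
    (hw : ContinuousOn w (Set.Icc 0 1))
    (hr : ∀ x ∈ Set.Icc (0:ℝ) 1, √(2 * k * (1 - x)) - r ≤ w x)
    (hs : s ∈ Set.Icc (0:ℝ) 1) :
    √(2 * (k + 1 : ℕ) * (1 - s)) - r - 2 / (k + 1 : ℕ) ≤
      (1 - hhat (k + 1) s + s) * w s + ∫ x in s..(hhat (k + 1) s), (1 + w x) := by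
  have hsh := le_hhat (k + 1) hs.2
  have hh := hhat_mem_Icc (k + 1) hs
  have hdelta := hhat_sub_self (Nat.le_add_left 1 k) hs.2
  rcases hs.2.eq_or_lt with rfl | hlt
  · have h1 : hhat (k + 1) 1 = 1 := le_antisymm hh.2 hsh
    have := hr 1 hs
    have h2 : (0:ℝ) ≤ 2 / (k + 1 : ℕ) := by positivity
    simp only [h1, integral_same, sub_self, mul_zero, Real.sqrt_zero, zero_add, one_mul,
      add_zero] at this ⊢
    linarith
  set h := hhat (k + 1) s
  set Y := √(1 - s)
  set a := √(2 * (k:ℝ))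
  set b := √(2 * ((k + 1 : ℕ) : ℝ))
  have hY : 0 < Y := Real.sqrt_pos.2 (by linarith)
  have hY2 : Y ^ 2 = 1 - s := Real.sq_sqrt (by linarith)
  have ha : 0 ≤ a := Real.sqrt_nonneg _
  have ha2 : a ^ 2 = 2 * k := Real.sq_sqrt (by positivity)
  have hb : 0 < b := Real.sqrt_pos.2 (by positivity)
  have hb2 : b ^ 2 = 2 * (k + 1 : ℕ) := Real.sq_sqrt (by positivity)
  have hbY : √(2 * (k + 1 : ℕ) * (1 - s)) = b * Y := Real.sqrt_mul (by positivity) _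
  have hloss := step_loss_le ha hb (by rw [ha2, hb2]; push_cast; ring) hY
  rw [← hdelta] at hloss
  have hint : ∫ x in s..h, ((1 + a * Y - r) - a / (2 * Y) * (x - s)
      - a / (2 * Y ^ 3) * (x - s) ^ 2) ≤ ∫ x in s..h, (1 + w x) := by
    refine intervalIntegral.integral_mono_on hsh
      (Continuous.intervalIntegrable (by fun_prop) _ _) ?_ fun x hx => ?_
    · refine ContinuousOn.intervalIntegrable ((continuousOn_const.add hw).mono ?_)
      rw [Set.uIcc_of_le hsh]
      exact Set.Icc_subset_Icc hs.1 hh.2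
    · have h1 := hr x ⟨hs.1.trans hx.1, hx.2.trans hh.2⟩
      rw [Real.sqrt_mul (by positivity), show 1 - x = Y ^ 2 - (x - s) by rw [hY2]; ring] at h1
      have h2 := mul_le_mul_of_nonneg_left (quadratic_le_sqrt hY (sub_nonneg.2 hx.1)
        (by linarith [hx.2, hh.2])) ha
      have h3 : a * (Y - (x - s) / (2 * Y) - (x - s) ^ 2 / (2 * Y ^ 3)) =
          a * Y - a / (2 * Y) * (x - s) - a / (2 * Y ^ 3) * (x - s) ^ 2 := by ring
      linarith
  rw [integral_quadratic] at hint
  have hws := hr s hs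
  rw [Real.sqrt_mul (by positivity)] at hws
  have hw1 := mul_le_mul_of_nonneg_left hws
    (by linarith [hs.1, hh.2] : 0 ≤ 1 - h + s)
  have h4 : 4 / b ^ 2 = 2 / (k + 1 : ℕ) := by
    rw [hb2]
    field_simp
    norm_num
  have h5 : a / (2 * Y) * (h - s) ^ 2 / 2 = a * (h - s) ^ 2 / (4 * Y) := by
    ring
  have h6 : a / (2 * Y ^ 3) * (h - s) ^ 3 / 3 = a * (h - s) ^ 3 / (6 * Y ^ 3) := by
    ring
  rw [hbY]
  rw [h5, h6] at hint
  linarith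

theorem inv_succ_le_log_sub_log {k : ℕ} (hk : 1 ≤ k) :
    1 / ((k + 1 : ℕ) : ℝ) ≤ Real.log (k + 1 : ℕ) - Real.log k := by
  have hk' : (0:ℝ) < k := by exact_mod_cast hk
  have h := Real.one_sub_inv_le_log_of_pos (x := ((k + 1 : ℕ) : ℝ) / k) (by positivity)
  rw [Real.log_div (by positivity) hk'.ne'] at h
  refine le_of_eq_of_le ?_ h
  push_cast
  field_simp
  ring

/-- the value functions `v̂_k`, determined by `v̂_0 ≡ 0` and the recursion
`v̂_k(s) = (1 − ĥ_k(s) + s) v̂_{k-1}(s) + ∫_s^{ĥ_k(s)} (1 + v̂_{k-1}(x)) dx`, satisfy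
`v̂_k(s) ≥ (2k(1-s))^{1/2} − 2(log k + 1)` for all `k ≥ 1` and `s ∈ [0,1]`. -/
theorem stmt_1 (v : ℕ → ℝ → ℝ)
    (hv0 : ∀ s ∈ Set.Icc (0:ℝ) 1, v 0 s = 0)
    (hv : ∀ k : ℕ, 1 ≤ k → ∀ s ∈ Set.Icc (0:ℝ) 1,
      v k s = (1 - hhat k s + s) * v (k-1) s + ∫ x in s..(hhat k s), (1 + v (k-1) x)) :
    ∀ k : ℕ, 1 ≤ k → ∀ s ∈ Set.Icc (0:ℝ) 1,
      Real.sqrt (2 * k * (1 - s)) - 2 * (Real.log k + 1) ≤ v k s := by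
  intro k hk
  induction k, hk using Nat.le_induction with
  | base =>
    intro s hs
    have hsh := le_hhat 1 hs.2
    rw [hv 1 le_rfl s hs, Nat.sub_self, hv0 s hs, mul_zero, zero_add]
    have h1 : 0 ≤ ∫ x in s..(hhat 1 s), (1 + v 0 x) :=
      intervalIntegral.integral_nonneg hsh fun x hx => by
        rw [hv0 x ⟨hs.1.trans hx.1, hx.2.trans (hhat_le_one 1 s)⟩]
        norm_num
    have h2 : √(2 * (1 : ℕ) * (1 - s)) ≤ 2 := by
      rw [Real.sqrt_le_left (by norm_num)]
      push_cast
      linarith [hs.1]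
    have h3 : Real.log (1 : ℕ) = 0 := by simp
    rw [h3]
    linarith
  | succ k hk ih =>
    intro s hs
    have h1 := recursion_lower_bound (continuousOn_value v hv0 hv k) ih hs
    have h2 := inv_succ_le_log_sub_log hk
    rw [hv (k + 1) (Nat.le_add_left 1 k) s hs, Nat.add_sub_cancel]
    have h3 : 2 / ((k + 1 : ℕ) : ℝ) = 2 * (1 / ((k + 1 : ℕ) : ℝ)) := by ring
    linarith
end

section
/- For each integer k ≥ 1, define δ_k : [0,1] → ℝ by δ_k(s) = (2k(1-s))^{1/2} − (2(k-1)(1-s))^{1/2} + ∫_s^{ĥ_k(s)} [ (2(k-1)(1-s))^{1/2} − (2(k-1)(1-x))^{1/2} − 1 ] dx, where ĥ_k(s) = min{ s + (2(1-s)/k)^{1/2}, 1 }. Then δ_k(s) ≤ 2/k for all s ∈ [0,1] and all k ≥ 1. -/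
open MeasureTheory intervalIntegral

/-- The residual-difference function `δ_k`. -/
noncomputable def deltaFn (k : ℕ) (s : ℝ) : ℝ :=
  Real.sqrt (2 * k * (1 - s)) - Real.sqrt (2 * ((k:ℝ) - 1) * (1 - s)) +
    ∫ x in s..(hhat k s),
      (Real.sqrt (2 * ((k:ℝ) - 1) * (1 - s)) - Real.sqrt (2 * ((k:ℝ) - 1) * (1 - x)) - 1)

lemma one_sub_half_sub_half_sq_le_sqrt {z : ℝ} (h0 : 0 ≤ z) (h1 : z ≤ 1) :
    1 - z / 2 - z ^ 2 / 2 ≤ Real.sqrt (1 - z) := by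
  apply Real.le_sqrt_of_sq_le
  have h : (1 - z) - (1 - z / 2 - z ^ 2 / 2) ^ 2 = (1 - z) * (z ^ 2 * (3 + z) / 4) := by ring
  have : 0 ≤ (1 - z) * (z ^ 2 * (3 + z) / 4) := mul_nonneg (by linarith) (by positivity)
  linarith

lemma sqrt_mul_sub_sqrt_mul_sub_le {m u y : ℝ} (hm : 0 ≤ m) (hu : 0 < u) (h0 : 0 ≤ y)
    (h1 : y ≤ u) :
    Real.sqrt (m * u) - Real.sqrt (m * (u - y)) ≤
      Real.sqrt (m * u) * (y / (2 * u) + y ^ 2 / (2 * u ^ 2)) := by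
  have h := one_sub_half_sub_half_sq_le_sqrt (z := y / u) (by positivity) ((div_le_one hu).2 h1)
  have e : m * (u - y) = m * u * (1 - y / u) := by field_simp
  rw [e, Real.sqrt_mul (mul_nonneg hm hu.le) (1 - y / u)]
  have h' := mul_le_mul_of_nonneg_left h (Real.sqrt_nonneg (m * u))
  have e' : y / (2 * u) + y ^ 2 / (2 * u ^ 2) = y / u / 2 + (y / u) ^ 2 / 2 := by
    field_simp
  rw [e']
  linarith

lemma integral_sqrt_mul_sub_le {m s b : ℝ} (hm : 0 ≤ m) (hs : s < 1) (hb : s ≤ b) (hb1 : b ≤ 1) :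
    (∫ x in s..b, (Real.sqrt (m * (1 - s)) - Real.sqrt (m * (1 - x)) - 1)) ≤
      Real.sqrt (m * (1 - s)) *
        ((b - s) ^ 2 / (4 * (1 - s)) + (b - s) ^ 3 / (6 * (1 - s) ^ 2)) - (b - s) := by
  have hu : 0 < 1 - s := by linarith
  set C := Real.sqrt (m * (1 - s)) with hC
  have hint : (∫ x in s..b, (C * ((x - s) / (2 * (1 - s)) + (x - s) ^ 2 / (2 * (1 - s) ^ 2)) - 1)) =
      C * ((b - s) ^ 2 / (4 * (1 - s)) + (b - s) ^ 3 / (6 * (1 - s) ^ 2)) - (b - s) := by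
    have hd : ∀ x ∈ Set.uIcc s b, HasDerivAt
        (fun x => C * ((x - s) ^ 2 / (4 * (1 - s)) + (x - s) ^ 3 / (6 * (1 - s) ^ 2)) - (x - s))
        (C * ((x - s) / (2 * (1 - s)) + (x - s) ^ 2 / (2 * (1 - s) ^ 2)) - 1) x := by
      intro x _
      have h1 : HasDerivAt (fun x : ℝ => x - s) 1 x := (hasDerivAt_id x).sub_const s
      convert! ((((h1.pow 2).div_const (4 * (1 - s))).add
        ((h1.pow 3).div_const (6 * (1 - s) ^ 2))).const_mul C).sub h1 using 1
      norm_num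
      left
      field_simp
      ring
    rw [integral_eq_sub_of_hasDerivAt hd (Continuous.intervalIntegrable (by fun_prop) _ _)]
    ring
  rw [← hint]
  refine integral_mono_on hb (Continuous.intervalIntegrable (by fun_prop) _ _)
    (Continuous.intervalIntegrable (by fun_prop) _ _) fun x hx => ?_
  have h := sqrt_mul_sub_sqrt_mul_sub_le (y := x - s) hm hu (by linarith [hx.1]) (by linarith [hx.2])
  rw [show 1 - s - (x - s) = 1 - x by ring] at h
  linarith

lemma residual_bound_of_two_le {P C u : ℝ} (hP : 2 ≤ P) (hC : 0 ≤ C) (hCP : C ≤ P)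
    (hsq : C ^ 2 = P ^ 2 - 2 * u) :
    P - C + (C * ((2 * u / P) ^ 2 / (4 * u) + (2 * u / P) ^ 3 / (6 * u ^ 2)) - 2 * u / P) ≤
      4 * u / P ^ 2 := by
  have hP0 : 0 < P := by linarith
  obtain rfl : u = (P ^ 2 - C ^ 2) / 2 := by linarith
  rcases hCP.eq_or_lt with rfl | hlt
  · simp
  have hu : 0 < (P ^ 2 - C ^ 2) / 2 := by nlinarith
  set u := (P ^ 2 - C ^ 2) / 2 with hu_def
  have e : 4 * u / P ^ 2 - (P - C + (C * ((2 * u / P) ^ 2 / (4 * u) +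
      (2 * u / P) ^ 3 / (6 * u ^ 2)) - 2 * u / P)) =
      (4 * u * P - (P - C) * P ^ 3 - C * u * P - 4 / 3 * C * u + 2 * u * P ^ 2) / P ^ 3 := by
    field_simp
    ring
  have h : 0 ≤ (4 * u * P - (P - C) * P ^ 3 - C * u * P - 4 / 3 * C * u + 2 * u * P ^ 2) := by
    have e2 : 4 * u * P - (P - C) * P ^ 3 - C * u * P - 4 / 3 * C * u + 2 * u * P ^ 2 =
        u * (4 * P - 4 / 3 * C) + P * C * (P - C) ^ 2 / 2 := by
      rw [hu_def]; ring
    rw [e2]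
    have : 0 ≤ 4 * P - 4 / 3 * C := by linarith
    positivity
  have := div_nonneg h (pow_pos hP0 3).le
  linarith

lemma residual_bound_of_le_two {P C u : ℝ} (hP0 : 0 < P) (hP : P ≤ 2) (hC : 0 ≤ C) (hCP : C ≤ P)
    (hu : 0 < u) (hsq : C ^ 2 = P ^ 2 - 2 * u) :
    P - C + (C * (u ^ 2 / (4 * u) + u ^ 3 / (6 * u ^ 2)) - u) ≤ 4 * u / P ^ 2 := by
  have e : u ^ 2 / (4 * u) + u ^ 3 / (6 * u ^ 2) = 5 / 12 * u := by field_simp; norm_num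
  rw [e]
  have h1 : P - C ≤ 2 * u / P := by
    rw [le_div_iff₀ hP0]
    nlinarith
  have h2 : 2 * u / P ≤ 4 * u / P ^ 2 := by
    rw [div_le_div_iff₀ hP0 (by positivity)]
    nlinarith [mul_nonneg (mul_pos hu hP0).le (sub_nonneg.2 hP)]
  nlinarith

/-- `δ_k(s) ≤ 2/k` for all `s ∈ [0,1]` and all `k ≥ 1`. -/
theorem stmt_6 : ∀ k : ℕ, 1 ≤ k → ∀ s ∈ Set.Icc (0:ℝ) 1, deltaFn k s ≤ 2 / (k:ℝ) := by
  intro k hk s hs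
  have hk1 : (1:ℝ) ≤ k := by exact_mod_cast hk
  have hk0 : (0:ℝ) < k := by linarith
  rcases hs.2.eq_or_lt with rfl | hlt
  · simpa [deltaFn, hhat] using (div_pos two_pos hk0).le
  have hu : 0 < 1 - s := by linarith
  have hm : (0:ℝ) ≤ 2 * ((k:ℝ) - 1) := by linarith
  have hb : s ≤ hhat k s := le_min (by linarith [Real.sqrt_nonneg (2 * (1 - s) / k)]) hs.2
  have hI := integral_sqrt_mul_sub_le hm hlt hb (min_le_right _ _)
  unfold deltaFn
  refine (add_le_add_right hI _).trans ?_
  have hP0 : 0 < Real.sqrt (2 * k * (1 - s)) := Real.sqrt_pos.2 (by positivity)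
  have hP2 : Real.sqrt (2 * k * (1 - s)) ^ 2 = 2 * k * (1 - s) := Real.sq_sqrt (by positivity)
  have hC0 := Real.sqrt_nonneg (2 * ((k:ℝ) - 1) * (1 - s))
  have hC2 : Real.sqrt (2 * ((k:ℝ) - 1) * (1 - s)) ^ 2 = 2 * ((k:ℝ) - 1) * (1 - s) :=
    Real.sq_sqrt (by positivity)
  have hCP : Real.sqrt (2 * ((k:ℝ) - 1) * (1 - s)) ≤ Real.sqrt (2 * k * (1 - s)) :=
    Real.sqrt_le_sqrt (by nlinarith)
  have ha : Real.sqrt (2 * (1 - s) / k) = 2 * (1 - s) / Real.sqrt (2 * k * (1 - s)) := by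
    rw [Real.sqrt_eq_iff_mul_self_eq (by positivity) (by positivity), ← sq, div_pow, hP2]
    field_simp
  have hr : 2 / (k:ℝ) = 4 * (1 - s) / Real.sqrt (2 * k * (1 - s)) ^ 2 := by
    rw [hP2]
    field_simp
    norm_num
  unfold hhat
  rw [ha, hr]
  generalize Real.sqrt (2 * k * (1 - s)) = P at *
  generalize Real.sqrt (2 * ((k:ℝ) - 1) * (1 - s)) = C at *
  have hsq : C ^ 2 = P ^ 2 - 2 * (1 - s) := by rw [hC2, hP2]; ring
  rcases le_total 2 P with h | h
  · have : 2 * (1 - s) / P ≤ 1 - s := by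
      rw [div_le_iff₀ hP0]
      nlinarith
    rw [min_eq_left (by linarith), add_sub_cancel_left]
    exact residual_bound_of_two_le h hC0 hCP hsq
  · have : 1 - s ≤ 2 * (1 - s) / P := by
      rw [le_div_iff₀ hP0]
      nlinarith
    rw [min_eq_right (by linarith)]
    exact residual_bound_of_le_two hP0 h hC0 hCP hu hsq
end

section
/- Let (v̂_k)_{k ≥ 0} be the functions on [0,1] determined by v̂_0(s) = 0 and the recursion v̂_k(s) = (1 − ĥ_k(s) + s) v̂_{k-1}(s) + ∫_s^{ĥ_k(s)} (1 + v̂_{k-1}(x)) dx, where ĥ_k(s) = min{ s + (2(1-s)/k)^{1/2}, 1 }. Define r_k(s) = (2k(1-s))^{1/2} − v̂_k(s), the maximal residual r̄_{k} = max_{0 ≤ t ≤ 1} r_{k}(t), and δ_k(s) = (2k(1-s))^{1/2} − (2(k-1)(1-s))^{1/2} + ∫_s^{ĥ_k(s)} [ (2(k-1)(1-s))^{1/2} − (2(k-1)(1-x))^{1/2} − 1 ] dx. Then for all k ≥ 1 and all s ∈ [0,1], r_k(s) ≤ δ_k(s) + r̄_{k-1}; in particular r_k(s) − r̄_{k-1}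 ≤ 2/k. -/
open MeasureTheory intervalIntegral

/-- One step of the threshold recursion preserves continuity on `[0, 1]`. -/
theorem continuousOn_threshold_step {f : ℝ → ℝ} (hf : ContinuousOn f (Set.Icc 0 1)) (k : ℕ) :
    ContinuousOn (fun s => (1 - hhat k s + s) * f s + ∫ x in s..(hhat k s), (1 + f x))
      (Set.Icc 0 1) := by
  have hg : ContinuousOn (fun x => 1 + f x) (Set.Icc 0 1) := continuousOn_const.add hf
  have hF : ContinuousOn (fun t => ∫ x in (0:ℝ)..t, (1 + f x)) (Set.Icc 0 1) :=
    intervalIntegral.continuousOn_primitive_interval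
      (by rw [Set.uIcc_of_le zero_le_one]; exact hg.integrableOn_Icc) |>.mono
      (by rw [Set.uIcc_of_le zero_le_one])
  have hmaps : Set.MapsTo (hhat k) (Set.Icc 0 1) (Set.Icc 0 1) := fun s hs =>
    ⟨hs.1.trans (le_hhat k hs.2), hhat_le_one k s⟩
  have hh : ContinuousOn (hhat k) (Set.Icc 0 1) := (continuous_hhat k).continuousOn
  have hint : ∀ t ∈ Set.Icc (0:ℝ) 1, IntervalIntegrable (fun x => 1 + f x) volume 0 t := by
    intro t ht
    refine ContinuousOn.intervalIntegrable (hg.mono ?_)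
    rw [Set.uIcc_of_le ht.1]
    exact Set.Icc_subset_Icc_right ht.2
  refine ContinuousOn.add (((continuousOn_const.sub hh).add continuousOn_id).mul hf) ?_
  refine ((hF.comp hh hmaps).sub hF).congr fun s hs => ?_
  exact (intervalIntegral.integral_interval_sub_left (hint _ (hmaps hs)) (hint _ hs)).symm

/-- Second-order upper bound for the drop of the square root below the point `σ ^ 2`. -/
theorem sub_sqrt_le {σ y : ℝ} (hσ : 0 < σ) (hy : 0 ≤ y) (hyu : y ≤ σ ^ 2) :
    σ - √(σ ^ 2 - y) ≤ y / (2 * σ) + y ^ 2 / (2 * σ ^ 3) := by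
  set q := √(σ ^ 2 - y) with hq
  have hq0 : 0 ≤ q := Real.sqrt_nonneg _
  have hq2 : q ^ 2 = σ ^ 2 - y := Real.sq_sqrt (by linarith)
  have hqσ : q ≤ σ := by nlinarith
  have hy2 : y = (σ - q) * (σ + q) := by linarith
  clear_value q
  clear hq
  subst hy2
  rw [div_add_div _ _ (by positivity) (by positivity), le_div_iff₀ (by positivity)]
  have h : 0 ≤ (σ - q) ^ 2 * σ * (q * (2 * σ + q)) := by positivity
  nlinarith

/-- The elementary inequality behind `deltaFn_le`, for the interior threshold. -/
theorem interior_bound {K M σ c : ℝ} (hK : 0 < K) (hM : 0 ≤ M) (hKM : K ^ 2 = M ^ 2 + 1)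
    (hσ : 0 < σ) (hc : 0 ≤ c) (hc2 : c ^ 2 = 2) :
    c * σ * (K - M) - c * σ / K +
      c * M * ((c * σ / K) ^ 2 / (4 * σ) + (c * σ / K) ^ 3 / (6 * σ ^ 3)) ≤ 2 / K ^ 2 := by
  have hMK : M ≤ K := by nlinarith
  have e : c * σ * (K - M) - c * σ / K +
      c * M * ((c * σ / K) ^ 2 / (4 * σ) + (c * σ / K) ^ 3 / (6 * σ ^ 3)) =
      - (c * σ * M * (K - M) ^ 2) / (2 * K ^ 2) + 2 * M / (3 * K ^ 3) := by
    have hc4 : c ^ 4 = 4 := by rw [show c ^ 4 = (c ^ 2) ^ 2 by ring, hc2]; norm_num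
    have hc3 : c ^ 3 = 2 * c := by rw [pow_succ, hc2]
    field_simp
    ring_nf
    simp only [hc4, hc3]
    have hM2 : M ^ 2 = K ^ 2 - 1 := by linarith
    have hM3 : M ^ 3 = M * (K ^ 2 - 1) := by rw [pow_succ, hM2]; ring
    simp only [hM3, hM2]
    ring
  rw [e]
  have h1 : - (c * σ * M * (K - M) ^ 2) / (2 * K ^ 2) ≤ 0 :=
    div_nonpos_of_nonpos_of_nonneg (neg_nonpos.2 (by positivity)) (by positivity)
  have h2 : 2 * M / (3 * K ^ 3) ≤ 2 / K ^ 2 := by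
    rw [div_le_div_iff₀ (by positivity) (by positivity)]
    nlinarith [mul_le_mul_of_nonneg_right hMK (sq_nonneg K), pow_pos hK 3]
  linarith

/-- The elementary inequality behind `deltaFn_le`, for the truncated threshold. -/
theorem truncated_bound {K M σ c : ℝ} (hK : 0 < K) (hM : 0 ≤ M) (hKM : K ^ 2 = M ^ 2 + 1)
    (hσ : 0 < σ) (hc : 0 ≤ c) (hc2 : c ^ 2 = 2) (hle : σ * K ≤ c) :
    c * σ * (K - M) - σ ^ 2 +
      c * M * ((σ ^ 2) ^ 2 / (4 * σ) + (σ ^ 2) ^ 3 / (6 * σ ^ 3)) ≤ 2 / K ^ 2 := by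
  have hMK : M ≤ K := by nlinarith
  have e : (σ ^ 2) ^ 2 / (4 * σ) + (σ ^ 2) ^ 3 / (6 * σ ^ 3) = 5 / 12 * σ ^ 3 := by
    field_simp; norm_num
  rw [e, le_div_iff₀ (by positivity)]
  have hKM1 : K * (K - M) ≤ 1 := by nlinarith
  have h1 : c * σ * K * (K * (K - M)) ≤ c * σ * K * 1 := by gcongr
  have h2 : c * M * (5 / 12 * σ ^ 3) * K ^ 2 ≤ c * K * (5 / 12 * σ ^ 3) * K ^ 2 := by gcongr
  have hp : 0 ≤ σ * K := by positivity
  set p := σ * K with hpdef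
  have h3 : c * p - p ^ 2 + 5 / 12 * (c * p) * p ^ 2 ≤ 2 := by
    have h4 : c * p ≤ 2 := by nlinarith
    have h5 : p ^ 2 ≤ c * p := by nlinarith
    have h6 : 0 ≤ c * p := by positivity
    have h7 : 2 * p ^ 2 = (c * p) ^ 2 := by rw [mul_pow c p, hc2]
    nlinarith [mul_nonneg h6 (sub_nonneg.2 h4), mul_nonneg (sq_nonneg p) (sub_nonneg.2 h4)]
  have e2 : c * K * (5 / 12 * σ ^ 3) * K ^ 2 = 5 / 12 * (c * p) * p ^ 2 := by rw [hpdef]; ring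
  have e3 : c * σ * K = c * p := by rw [hpdef]; ring
  have e4 : σ ^ 2 * K ^ 2 = p ^ 2 := by rw [hpdef]; ring
  nlinarith

theorem deltaFn_le {k : ℕ} (hk : 1 ≤ k) {s : ℝ} (hs : s ≤ 1) : deltaFn k s ≤ 2 / k := by
  have hk1 : (1:ℝ) ≤ k := by exact_mod_cast hk
  have hk0 : (0:ℝ) < k := by linarith
  rcases hs.eq_or_lt with rfl | hs1
  · have : hhat k 1 = 1 := le_antisymm (hhat_le_one k 1) (le_hhat k le_rfl)
    simp only [deltaFn, this, sub_self, mul_zero, Real.sqrt_zero, intervalIntegral.integral_same,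
      add_zero]
    positivity
  obtain ⟨σ, hσdef⟩ : ∃ σ, σ = √(1 - s) := ⟨_, rfl⟩
  obtain ⟨K, hKdef⟩ : ∃ K, K = √(k:ℝ) := ⟨_, rfl⟩
  obtain ⟨M, hMdef⟩ : ∃ M, M = √((k:ℝ) - 1) := ⟨_, rfl⟩
  obtain ⟨c, hcdef⟩ : ∃ c, c = √(2:ℝ) := ⟨_, rfl⟩
  have hσ : 0 < σ := hσdef ▸ Real.sqrt_pos.2 (by linarith)
  have hK : 0 < K := hKdef ▸ Real.sqrt_pos.2 hk0
  have hM : 0 ≤ M := hMdef ▸ Real.sqrt_nonneg _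
  have hc : 0 ≤ c := hcdef ▸ Real.sqrt_nonneg _
  have hσ2 : σ ^ 2 = 1 - s := by rw [hσdef, Real.sq_sqrt (by linarith)]
  have hK2 : K ^ 2 = k := by rw [hKdef, Real.sq_sqrt hk0.le]
  have hM2 : M ^ 2 = (k:ℝ) - 1 := by rw [hMdef, Real.sq_sqrt (by linarith)]
  have hc2 : c ^ 2 = 2 := by rw [hcdef, Real.sq_sqrt (by norm_num)]
  have hKM : K ^ 2 = M ^ 2 + 1 := by linarith
  have hsh := le_hhat k hs
  have hh1 := hhat_le_one k s
  have eM (x : ℝ) : √(2 * ((k:ℝ) - 1) * (1 - x)) = c * M * √(1 - x) := by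
    rw [Real.sqrt_mul (by nlinarith), Real.sqrt_mul (by norm_num), hcdef, hMdef]
  have eK : √(2 * (k:ℝ) * (1 - s)) = c * K * σ := by
    rw [Real.sqrt_mul (by positivity), Real.sqrt_mul (by norm_num), hcdef, hKdef, hσdef]
  have eW : √(2 * (1 - s) / k) = c * σ / K := by
    rw [Real.sqrt_div (by linarith), Real.sqrt_mul (by norm_num), hcdef, hKdef, hσdef]
  have hint : (∫ x in s..(hhat k s), (√(2 * ((k:ℝ) - 1) * (1 - s)) -
        √(2 * ((k:ℝ) - 1) * (1 - x)) - 1)) ≤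
      ∫ x in s..(hhat k s),
        (c * M * ((x - s) / (2 * σ) + (x - s) ^ 2 / (2 * σ ^ 3)) - 1) := by
    refine intervalIntegral.integral_mono_on hsh
      (Continuous.intervalIntegrable (by fun_prop) _ _)
      (Continuous.intervalIntegrable (by fun_prop) _ _) fun x hx => ?_
    rw [eM, eM, ← hσdef, ← mul_sub]
    have h := sub_sqrt_le hσ (sub_nonneg.2 hx.1) (by linarith [hx.2] : x - s ≤ σ ^ 2)
    rw [show σ ^ 2 - (x - s) = 1 - x by linarith] at h
    gcongr
  have hval : (∫ x in s..(hhat k s),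
        (c * M * ((x - s) / (2 * σ) + (x - s) ^ 2 / (2 * σ ^ 3)) - 1)) =
      c * M * ((hhat k s - s) ^ 2 / (4 * σ) + (hhat k s - s) ^ 3 / (6 * σ ^ 3))
        - (hhat k s - s) := by
    rw [intervalIntegral.integral_comp_sub_right
      (fun y => c * M * (y / (2 * σ) + y ^ 2 / (2 * σ ^ 3)) - 1) s,
      intervalIntegral.integral_sub (Continuous.intervalIntegrable (by fun_prop) _ _)
        (Continuous.intervalIntegrable (by fun_prop) _ _),
      intervalIntegral.integral_const_mul,
      intervalIntegral.integral_add (Continuous.intervalIntegrable (by fun_prop) _ _)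
        (Continuous.intervalIntegrable (by fun_prop) _ _),
      intervalIntegral.integral_div, intervalIntegral.integral_div]
    simp only [integral_id, integral_pow, intervalIntegral.integral_const, smul_eq_mul]
    simp only [sub_self]
    ring
  have hδ : deltaFn k s ≤ c * σ * (K - M) - (hhat k s - s) +
      c * M * ((hhat k s - s) ^ 2 / (4 * σ) + (hhat k s - s) ^ 3 / (6 * σ ^ 3)) := by
    have h := hint.trans_eq hval
    unfold deltaFn
    rw [eK]
    have := eM s
    rw [← hσdef] at this
    linarith
  refine hδ.trans ?_
  rw [← hK2]
  rcases le_total (s + c * σ / K) 1 with hle | hle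
  · have hw : hhat k s - s = c * σ / K := by
      rw [hhat, eW, min_eq_left hle]; ring
    rw [hw]
    exact interior_bound hK hM hKM hσ hc hc2
  · have hw : hhat k s - s = σ ^ 2 := by
      rw [hhat, eW, min_eq_right hle, hσ2]
    rw [hw]
    refine truncated_bound hK hM hKM hσ hc hc2 ?_
    have h : σ ^ 2 ≤ c * σ / K := by linarith
    rw [le_div_iff₀ hK] at h
    exact le_of_mul_le_mul_left (by linarith) hσ

/-- One step of the recursion, in terms of the residual of `f` with `k - 1` steps to go. -/
theorem residual_step_le {k : ℕ} {f : ℝ → ℝ} (hf : ContinuousOn f (Set.Icc 0 1)) {R : ℝ}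
    (hR : ∀ x ∈ Set.Icc (0:ℝ) 1, √(2 * ((k:ℝ) - 1) * (1 - x)) - f x ≤ R)
    {s : ℝ} (hs : s ∈ Set.Icc (0:ℝ) 1) :
    √(2 * k * (1 - s)) -
        ((1 - hhat k s + s) * f s + ∫ x in s..(hhat k s), (1 + f x)) ≤ deltaFn k s + R := by
  have hsh := le_hhat k hs.2
  have hh1 := hhat_le_one k s
  have hsub : Set.Icc s (hhat k s) ⊆ Set.Icc 0 1 := Set.Icc_subset_Icc hs.1 hh1
  set a : ℝ → ℝ := fun x => √(2 * ((k:ℝ) - 1) * (1 - x))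
  have hfi : IntervalIntegrable f volume s (hhat k s) :=
    ContinuousOn.intervalIntegrable (hf.mono (by rwa [Set.uIcc_of_le hsh]))
  have hac : Continuous a := by fun_prop
  have hai : IntervalIntegrable a volume s (hhat k s) := hac.intervalIntegrable _ _
  have hmono : (∫ x in s..(hhat k s), (a x - f x)) ≤ ∫ _ in s..(hhat k s), R :=
    intervalIntegral.integral_mono_on hsh (hai.sub hfi) intervalIntegrable_const
      fun x hx => hR x (hsub hx)
  rw [intervalIntegral.integral_sub hai hfi, intervalIntegral.integral_const, smul_eq_mul] at hmono
  have hδ : deltaFn k s = √(2 * k * (1 - s)) - a s +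
      ((hhat k s - s) * a s - (∫ x in s..(hhat k s), a x) - (hhat k s - s)) := by
    change _ + (∫ x in s..(hhat k s), (a s - a x - 1)) = _
    rw [intervalIntegral.integral_sub (intervalIntegrable_const.sub hai) intervalIntegrable_const,
      intervalIntegral.integral_sub intervalIntegrable_const hai]
    simp [a]
  rw [hδ, intervalIntegral.integral_add intervalIntegrable_const hfi,
    intervalIntegral.integral_const, smul_eq_mul, mul_one]
  have h := mul_le_mul_of_nonneg_left (hR s hs)
    (by linarith [hs.1] : 0 ≤ 1 - hhat k s + s)
  change _ * (a s - f s) ≤ _ at h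
  linarith

/-- `r_k(s) ≤ δ_k(s) + r̄_{k-1}`, and in particular `r_k(s) − r̄_{k-1} ≤ 2/k`,
where `r̄_k = max_{0 ≤ t ≤ 1} r_k(t)`. -/
theorem stmt_8 (v : ℕ → ℝ → ℝ)
    (hv0 : ∀ s ∈ Set.Icc (0:ℝ) 1, v 0 s = 0)
    (hv : ∀ k : ℕ, 1 ≤ k → ∀ s ∈ Set.Icc (0:ℝ) 1,
      v k s = (1 - hhat k s + s) * v (k-1) s + ∫ x in s..(hhat k s), (1 + v (k-1) x))
    (r : ℕ → ℝ → ℝ)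
    (hr : ∀ k : ℕ, ∀ s ∈ Set.Icc (0:ℝ) 1, r k s = Real.sqrt (2 * k * (1 - s)) - v k s)
    (rbar : ℕ → ℝ)
    (hrbar : ∀ k : ℕ, rbar k = sSup (r k '' Set.Icc (0:ℝ) 1)) :
    ∀ k : ℕ, 1 ≤ k → ∀ s ∈ Set.Icc (0:ℝ) 1,
      r k s ≤ deltaFn k s + rbar (k-1) ∧ r k s - rbar (k-1) ≤ 2 / (k:ℝ) := by
  have hcont : ∀ k, ContinuousOn (v k) (Set.Icc 0 1) := by
    intro k
    induction k with
    | zero => exact continuousOn_const.congr hv0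
    | succ n ih => exact (continuousOn_threshold_step ih (n + 1)).congr (hv (n + 1) (by omega))
  have hbdd : ∀ k, BddAbove (r k '' Set.Icc (0:ℝ) 1) := fun k =>
    isCompact_Icc.bddAbove_image
      ((ContinuousOn.sub (by fun_prop) (hcont k)).congr (hr k))
  intro k hk s hs
  have hmain : r k s ≤ deltaFn k s + rbar (k - 1) := by
    rw [hr k s hs, hv k hk s hs]
    refine residual_step_le (hcont (k - 1)) (fun x hx => ?_) hs
    have h := hr (k - 1) x hx
    rw [Nat.cast_pred hk] at h
    rw [← h, hrbar]
    exact le_csSup (hbdd _) (Set.mem_image_of_mem _ hx)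
  exact ⟨hmain, by linarith [deltaFn_le hk hs.2]⟩
end

section
/- For each integer k ≥ 3, let s_k = 1 − 2/k and define δ_k(s) = (2k(1-s))^{1/2} − (2(k-1)(1-s))^{1/2} + ∫_s^{ĥ_k(s)} [ (2(k-1)(1-s))^{1/2} − (2(k-1)(1-x))^{1/2} − 1 ] dx, where ĥ_k(s) = min{ s + (2(1-s)/k)^{1/2}, 1 }. Then δ_k is non-decreasing on the interval [0, s_k]. -/
open MeasureTheory intervalIntegral

/-- The closed form of `deltaFn` on the conservative regime, in the variable `t = √(1 - s)`. -/
noncomputable def conservativeForm (a c t : ℝ) : ℝ :=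
  2 / a * t - c * t + a * t * (c * t - 1)
    - 2 * c / 3 * (t ^ 3 - (t ^ 2 - a * t) * Real.sqrt (t ^ 2 - a * t))

lemma integral_sqrt_one_sub {s h : ℝ} (hsh : s ≤ h) (hh : h ≤ 1) :
    ∫ x in s..h, Real.sqrt (1 - x) =
      2 / 3 * ((1 - s) * Real.sqrt (1 - s) - (1 - h) * Real.sqrt (1 - h)) := by
  have key : ∫ x in s..h, Real.sqrt (1 - x) =
      (-(2 / 3) * ((1 - h) * Real.sqrt (1 - h))) - (-(2 / 3) * ((1 - s) * Real.sqrt (1 - s))) := by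
    refine integral_eq_sub_of_hasDerivAt_of_le
      (f := fun x => -(2 / 3) * ((1 - x) * Real.sqrt (1 - x))) hsh (by fun_prop) ?_ ?_
    · intro x hx
      have hpos : 0 < 1 - x := by linarith [hx.2]
      have hlin : HasDerivAt (fun x : ℝ => 1 - x) (-1) x := by
        simpa using (hasDerivAt_id x).const_sub 1
      refine ((hlin.mul (hlin.sqrt hpos.ne')).const_mul (-(2 / 3))).congr_deriv ?_
      have hr : 0 < Real.sqrt (1 - x) := Real.sqrt_pos.2 hpos
      have hsq := Real.sq_sqrt hpos.le
      field_simp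
      linarith
    · exact Continuous.intervalIntegrable (by fun_prop) _ _
  rw [key]
  ring

lemma conservative_slope_nonpos {a c : ℝ} (ha : 0 < a) (ha2 : a ^ 2 ≤ 1) (hc : 0 ≤ c)
    (hac : c ^ 2 * a ^ 2 = 4 - 2 * a ^ 2) : 2 / a - c - a + c * (a ^ 2 / 4) ≤ 0 := by
  have h : 2 - a ^ 2 ≤ c * a * (1 - a ^ 2 / 4) := by
    refine (le_abs_self _).trans (abs_le_of_sq_le_sq ?_ ?_)
    · have : (c * a * (1 - a ^ 2 / 4)) ^ 2 = (4 - 2 * a ^ 2) * (1 - a ^ 2 / 4) ^ 2 := by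
        rw [← hac]; ring
      rw [this]
      nlinarith [mul_nonneg (sub_nonneg.2 ha2) (sq_nonneg (a ^ 2)), sq_nonneg (a ^ 2)]
    · exact mul_nonneg (mul_nonneg hc ha.le) (by linarith)
  have : 2 / a - c - a + c * (a ^ 2 / 4) = (2 - a ^ 2 - c * a * (1 - a ^ 2 / 4)) / a := by
    field_simp
    ring
  rw [this]
  exact div_nonpos_of_nonpos_of_nonneg (by linarith) ha.le

lemma antitoneOn_conservativeForm {a c : ℝ} (ha : 0 < a) (ha2 : a ^ 2 ≤ 1) (hc : 0 ≤ c)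
    (hac : c ^ 2 * a ^ 2 = 4 - 2 * a ^ 2) :
    AntitoneOn (conservativeForm a c) (Set.Ici a) := by
  refine antitoneOn_of_hasDerivWithinAt_nonpos (f' := fun t => 2 / a - c - a +
      c * (Real.sqrt (t ^ 2 - a * t) * (2 * t - a) - 2 * (t ^ 2 - a * t)))
    (convex_Ici a) ?_ ?_ ?_
  · unfold conservativeForm
    fun_prop
  · intro t ht
    rw [interior_Ici, Set.mem_Ioi] at ht
    have hw : 0 < t ^ 2 - a * t := by nlinarith
    have hid : HasDerivAt (fun t : ℝ => t) 1 t := hasDerivAt_id t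
    have hwd : HasDerivAt (fun t : ℝ => t ^ 2 - a * t) (2 * t - a) t := by
      exact ((hasDerivAt_pow 2 t).sub (hid.const_mul a)).congr_deriv (by simp)
    have hd := (((hid.const_mul (2 / a)).sub (hid.const_mul c)).add
      ((hid.const_mul a).mul ((hid.const_mul c).sub_const 1))).sub
      (((hasDerivAt_pow 3 t).sub (hwd.mul (hwd.sqrt hw.ne'))).const_mul (2 * c / 3))
    refine (hd.congr_deriv ?_).hasDerivWithinAt
    have hr : 0 < Real.sqrt (t ^ 2 - a * t) := Real.sqrt_pos.2 hw
    have hdiv : (t ^ 2 - a * t) * ((2 * t - a) / (2 * Real.sqrt (t ^ 2 - a * t))) =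
        Real.sqrt (t ^ 2 - a * t) * (2 * t - a) / 2 := by
      have hsq := Real.sq_sqrt hw.le
      rw [mul_div_assoc', div_eq_div_iff (by positivity) two_ne_zero]
      linear_combination (-2 * (2 * t - a)) * hsq
    simp only [hdiv]
    push_cast
    ring
  · intro t ht
    rw [interior_Ici, Set.mem_Ioi] at ht
    have hw : 0 ≤ t ^ 2 - a * t := by nlinarith
    have hsq := Real.sq_sqrt hw
    have hbr : Real.sqrt (t ^ 2 - a * t) * (2 * t - a) - 2 * (t ^ 2 - a * t) ≤ a ^ 2 / 4 := by
      nlinarith [sq_nonneg ((2 * t - a) / 2 - Real.sqrt (t ^ 2 - a * t))]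
    have := conservative_slope_nonpos ha ha2 hc hac
    have := mul_le_mul_of_nonneg_left hbr hc
    linarith

lemma deltaFn_eq_conservativeForm {k : ℕ} (hk : 1 ≤ k) {s : ℝ} (hs : s ≤ 1 - 2 / (k : ℝ)) :
    deltaFn k s = conservativeForm (Real.sqrt (2 / k)) (Real.sqrt (2 * ((k : ℝ) - 1)))
      (Real.sqrt (1 - s)) := by
  have hk' : (1 : ℝ) ≤ k := by exact_mod_cast hk
  have hk0 : (0 : ℝ) < 2 / k := by positivity
  have hu : 0 ≤ 1 - s := by linarith
  set a := Real.sqrt (2 / k) with ha_def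
  set c := Real.sqrt (2 * ((k : ℝ) - 1)) with hc_def
  set t := Real.sqrt (1 - s) with ht_def
  have ha : 0 < a := Real.sqrt_pos.2 hk0
  have hat : a ≤ t := Real.sqrt_le_sqrt (by linarith)
  have ht2 : t ^ 2 = 1 - s := Real.sq_sqrt hu
  have hstep : Real.sqrt (2 * (1 - s) / k) = a * t := by
    rw [ha_def, ht_def, ← Real.sqrt_mul hk0.le]
    congr 1
    ring
  have hfac (x : ℝ) : Real.sqrt (2 * ((k : ℝ) - 1) * (1 - x)) = c * Real.sqrt (1 - x) :=
    Real.sqrt_mul (by linarith) _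
  have h2k : Real.sqrt (2 * k) = 2 / a := by
    rw [eq_div_iff ha.ne', ha_def, ← Real.sqrt_mul (by positivity),
      show 2 * (k : ℝ) * (2 / k) = 2 ^ 2 by field_simp]
    exact Real.sqrt_sq zero_le_two
  have hle : s + a * t ≤ 1 := by nlinarith
  have hh : hhat k s = s + a * t := by
    rw [hhat, hstep, min_eq_left hle]
  have hsh : s ≤ s + a * t := by nlinarith
  have hint : ∫ x in s..s + a * t, (c * t - c * Real.sqrt (1 - x) - 1) =
      a * t * (c * t - 1) - c * ∫ x in s..s + a * t, Real.sqrt (1 - x) := by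
    have hrw : (fun x : ℝ => c * t - c * Real.sqrt (1 - x) - 1) =
        fun x => (c * t - 1) - c * Real.sqrt (1 - x) := by
      funext x; ring
    rw [hrw, intervalIntegral.integral_sub (by simp)
      (Continuous.intervalIntegrable (by fun_prop) _ _),
      intervalIntegral.integral_const, intervalIntegral.integral_const_mul]
    simp
  have hw : 1 - (s + a * t) = t ^ 2 - a * t := by rw [ht2]; ring
  rw [deltaFn, hh, Real.sqrt_mul (by positivity), h2k]
  simp only [hfac, ← ht_def]
  rw [hint, integral_sqrt_one_sub hsh hle, hw, ← ht_def, ← ht2, conservativeForm]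
  ring

/-- for `k ≥ 3`, the function `δ_k` is non-decreasing on `[0, 1 − 2/k]`. -/
theorem stmt_10 (k : ℕ) (hk : 3 ≤ k) :
    MonotoneOn (deltaFn k) (Set.Icc (0:ℝ) (1 - 2/(k:ℝ))) := by
  intro x hx y hy hxy
  have hk' : (3 : ℝ) ≤ k := by exact_mod_cast hk
  have hk1 : 1 ≤ k := by omega
  rw [deltaFn_eq_conservativeForm hk1 hx.2, deltaFn_eq_conservativeForm hk1 hy.2]
  have ha : Real.sqrt (2 / (k : ℝ)) ^ 2 = 2 / k := Real.sq_sqrt (by positivity)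
  refine antitoneOn_conservativeForm (Real.sqrt_pos.2 (by positivity)) ?_ (Real.sqrt_nonneg _) ?_
    (Real.sqrt_le_sqrt (by linarith [hy.2])) (Real.sqrt_le_sqrt (by linarith [hx.2]))
    (Real.sqrt_le_sqrt (by linarith))
  · rw [ha, div_le_one (by positivity)]
    linarith
  · rw [ha, Real.sq_sqrt (by linarith)]
    field_simp
    ring
end

section
/- For each integer k ≥ 3, let s_k = 1 − 2/k and define δ_k(s) = (2k(1-s))^{1/2} − (2(k-1)(1-s))^{1/2} + ∫_s^{ĥ_k(s)} [ (2(k-1)(1-s))^{1/2} − (2(k-1)(1-x))^{1/2} − 1 ] dx, where ĥ_k(s) = min{ s + (2(1-s)/k)^{1/2}, 1 }. Then δ_k(s) ≤ δ_k(s_k) ≤ 4/(3k) for all s ∈ [0, s_k]. -/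
open MeasureTheory intervalIntegral

theorem integral_sqrt_of_nonneg {a b : ℝ} (ha : 0 ≤ a) (hb : 0 ≤ b) :
    ∫ x in a..b, Real.sqrt x = 2 / 3 * (b * Real.sqrt b - a * Real.sqrt a) := by
  have h : ∀ x : ℝ, 0 ≤ x → x ^ ((1:ℝ) / 2 + 1) = x * Real.sqrt x := fun x hx => by
    rw [Real.rpow_add_one' hx (by norm_num), Real.sqrt_eq_rpow, mul_comm]
  simp_rw [Real.sqrt_eq_rpow]
  rw [integral_rpow (Or.inl (by norm_num)), h a ha, h b hb]
  simp only [Real.sqrt_eq_rpow]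
  ring

theorem integral_const_sub_sqrt {c d a b : ℝ} (hc : 0 ≤ c) (ha : a ≤ 1) (hb : b ≤ 1) :
    ∫ x in a..b, (d - Real.sqrt (c * (1 - x)) - 1) =
      (d - 1) * (b - a) - Real.sqrt c *
        (2 / 3 * ((1 - a) * Real.sqrt (1 - a) - (1 - b) * Real.sqrt (1 - b))) := by
  have hsub : ∫ x in a..b, Real.sqrt (1 - x) =
      2 / 3 * ((1 - a) * Real.sqrt (1 - a) - (1 - b) * Real.sqrt (1 - b)) := by
    rw [intervalIntegral.integral_comp_sub_left (fun x => Real.sqrt x) 1]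
    exact integral_sqrt_of_nonneg (by linarith) (by linarith)
  have hcongr : ∀ x : ℝ, d - Real.sqrt (c * (1 - x)) - 1 =
      (d - 1) - Real.sqrt c * Real.sqrt (1 - x) := fun x => by
    rw [Real.sqrt_mul hc]; ring
  simp_rw [hcongr]
  rw [intervalIntegral.integral_sub (by simp)
    (Continuous.intervalIntegrable (by fun_prop) _ _),
    intervalIntegral.integral_const_mul, hsub, intervalIntegral.integral_const, smul_eq_mul]
  ring

/-- Closed form of `δ_k` in the conservative regime, in the variable `y = (k(1-s)/2)^{1/2}`,
where `r = (1 - 1/k)^{1/2}`. -/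
theorem deltaFn_eq {k : ℕ} (hk : 1 ≤ k) {r y : ℝ} (hr : 0 ≤ r) (hrk : r ^ 2 = 1 - 1 / (k:ℝ))
    (hy : 1 ≤ y) :
    deltaFn k (1 - 2 * y ^ 2 / k) =
      2 * y * (1 - r) + (2 * y * r - 1) * (2 * y / k) -
        8 * r / (3 * k) * (y ^ 3 - (y ^ 2 - y) * Real.sqrt (y ^ 2 - y)) := by
  have hK : (0:ℝ) < k := by exact_mod_cast hk
  have hK1 : (1:ℝ) ≤ k := by exact_mod_cast hk
  have hy0 : 0 ≤ y := by linarith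
  have hyy : 0 ≤ y ^ 2 - y := by nlinarith
  have hr' : (k:ℝ) * r ^ 2 = k - 1 := by rw [hrk]; field_simp
  have h1 : Real.sqrt (2 * k * (1 - (1 - 2 * y ^ 2 / k))) = 2 * y := by
    rw [show 2 * (k:ℝ) * (1 - (1 - 2 * y ^ 2 / k)) = (2 * y) ^ 2 by field_simp; ring]
    exact Real.sqrt_sq (by positivity)
  have h2 : Real.sqrt (2 * ((k:ℝ) - 1) * (1 - (1 - 2 * y ^ 2 / k))) = 2 * y * r := by
    rw [show 2 * ((k:ℝ) - 1) * (1 - (1 - 2 * y ^ 2 / k)) = (2 * y * r) ^ 2 by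
      rw [← hr']; field_simp; ring]
    exact Real.sqrt_sq (by positivity)
  have h3 : hhat k (1 - 2 * y ^ 2 / k) = 1 - 2 / k * (y ^ 2 - y) := by
    have : Real.sqrt (2 * (1 - (1 - 2 * y ^ 2 / k)) / k) = 2 * y / k := by
      rw [show 2 * (1 - (1 - 2 * y ^ 2 / k)) / (k:ℝ) = (2 * y / k) ^ 2 by field_simp; ring]
      exact Real.sqrt_sq (by positivity)
    have hnn : 0 ≤ 2 / (k:ℝ) * (y ^ 2 - y) := by positivity
    rw [hhat, this, show 1 - 2 * y ^ 2 / (k:ℝ) + 2 * y / k = 1 - 2 / k * (y ^ 2 - y) by ring]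
    exact min_eq_left (by linarith)
  have h4 : Real.sqrt (2 * ((k:ℝ) - 1)) * Real.sqrt (2 / k) = 2 * r := by
    rw [← Real.sqrt_mul (by linarith),
      show 2 * ((k:ℝ) - 1) * (2 / k) = (2 * r) ^ 2 by rw [← hr']; field_simp]
    exact Real.sqrt_sq (by positivity)
  have h5 : Real.sqrt (2 / k * y ^ 2) = Real.sqrt (2 / (k:ℝ)) * y := by
    rw [Real.sqrt_mul (by positivity), Real.sqrt_sq hy0]
  have h6 : Real.sqrt (2 / k * (y ^ 2 - y)) =
      Real.sqrt (2 / (k:ℝ)) * Real.sqrt (y ^ 2 - y) := Real.sqrt_mul (by positivity) _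
  rw [deltaFn, h1, h2, h3, integral_const_sub_sqrt (by linarith)
    (by have : 0 ≤ 2 * y ^ 2 / (k:ℝ) := by positivity
        linarith)
    (by have : 0 ≤ 2 / (k:ℝ) * (y ^ 2 - y) := by positivity
        linarith),
    show 1 - (1 - 2 * y ^ 2 / (k:ℝ)) = 2 / k * y ^ 2 by ring, sub_sub_cancel, h5, h6]
  linear_combination (-(2 / 3) * (2 / (k:ℝ)) * (y ^ 3 - (y ^ 2 - y) * Real.sqrt (y ^ 2 - y))) * h4

theorem sub_mul_sqrt_sub_le {y : ℝ} (hy : 1 ≤ y) :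
    8 / 3 * ((y ^ 2 - y) * Real.sqrt (y ^ 2 - y)) ≤ 8 / 3 * y ^ 3 - 4 * y ^ 2 + y + 1 / 3 := by
  have hy0 : 0 < y := by linarith
  have hyy : 0 ≤ y ^ 2 - y := by nlinarith
  have hinv : 1 / (8 * y) ≤ 1 / 8 := by
    apply one_div_le_one_div_of_le <;> linarith
  have hw : Real.sqrt (y ^ 2 - y) ≤ y - 1 / 2 - 1 / (8 * y) := by
    apply Real.sqrt_le_iff.mpr ⟨by linarith, ?_⟩
    have : (y - 1 / 2 - 1 / (8 * y)) ^ 2 = y ^ 2 - y + 1 / (8 * y) + (1 / (8 * y)) ^ 2 := by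
      field_simp; ring
    rw [this]
    have : 0 < 1 / (8 * y) := by positivity
    nlinarith
  calc 8 / 3 * ((y ^ 2 - y) * Real.sqrt (y ^ 2 - y))
      ≤ 8 / 3 * ((y ^ 2 - y) * (y - 1 / 2 - 1 / (8 * y))) := by gcongr
    _ = 8 / 3 * y ^ 3 - 4 * y ^ 2 + y + 1 / 3 := by field_simp; ring

/-- for `k ≥ 3` and `s_k = 1 − 2/k`,
`δ_k(s) ≤ δ_k(s_k) ≤ 4/(3k)` for all `s ∈ [0, s_k]`. -/
theorem stmt_11 (k : ℕ) (hk : 3 ≤ k) :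
    ∀ s ∈ Set.Icc (0:ℝ) (1 - 2/(k:ℝ)),
      deltaFn k s ≤ deltaFn k (1 - 2/(k:ℝ)) ∧ deltaFn k (1 - 2/(k:ℝ)) ≤ 4 / (3*(k:ℝ)) := by
  rintro s ⟨-, hs⟩
  have hk1 : 1 ≤ k := by omega
  have hK : (1:ℝ) ≤ k := by exact_mod_cast hk1
  have hK0 : (0:ℝ) < k := by linarith
  have hinv : 1 / (k:ℝ) ≤ 1 := by rw [div_le_one hK0]; exact hK
  obtain ⟨r, hr, hrk⟩ : ∃ r : ℝ, 0 ≤ r ∧ r ^ 2 = 1 - 1 / (k:ℝ) :=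
    ⟨_, Real.sqrt_nonneg _, Real.sq_sqrt (by linarith)⟩
  have hr1 : r ≤ 1 := by
    have : 0 < 1 / (k:ℝ) := by positivity
    nlinarith
  obtain ⟨y, hy, rfl⟩ : ∃ y : ℝ, 1 ≤ y ∧ s = 1 - 2 * y ^ 2 / k := by
    have h : 1 ≤ k * (1 - s) / 2 := by
      have : 2 / (k:ℝ) ≤ 1 - s := by linarith
      rw [div_le_iff₀ hK0] at this
      linarith
    refine ⟨Real.sqrt (k * (1 - s) / 2), Real.one_le_sqrt.mpr h, ?_⟩
    rw [Real.sq_sqrt (by linarith)]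
    field_simp
    ring
  have hone := deltaFn_eq hk1 hr hrk le_rfl
  rw [show 1 - 2 * (1:ℝ) ^ 2 / k = 1 - 2 / k by ring] at hone
  have hq : 1 / (k:ℝ) = 1 - r ^ 2 := by linarith
  have hdiv : ∀ a : ℝ, a / k = a * (1 - r ^ 2) := fun a => by rw [← hq]; ring
  have hdiv3 : ∀ a : ℝ, a / (3 * k) = a / 3 * (1 - r ^ 2) := fun a => by rw [← hq]; ring
  rw [deltaFn_eq hk1 hr hrk hy, hone]
  simp only [hdiv, hdiv3]
  have hr2 : 0 ≤ 1 - r := by linarith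
  constructor
  · have hkey := sub_mul_sqrt_sub_le hy
    set W := (y ^ 2 - y) * Real.sqrt (y ^ 2 - y)
    have hf : 0 ≤ (1 - r) * (1 + r) * r := by positivity
    have h1 := mul_le_mul_of_nonneg_left hkey hf
    have h2 : 0 ≤ r * (1 - r) * (1 - r) * (y - 1) :=
      mul_nonneg (by positivity) (by linarith)
    norm_num
    linarith
  · norm_num
    nlinarith [mul_nonneg hr hr2, mul_nonneg hr2 hr2, mul_nonneg (mul_nonneg hr hr2) hr2]
end

section
/- Fix an integer k ≥ 3 and let s_k = 1 − 2/k. Define δ_k(s) = (2k(1-s))^{1/2} − (2(k-1)(1-s))^{1/2} + ∫_s^{s + (2(1-s)/k)^{1/2}} [ (2(k-1)(1-s))^{1/2} − (2(k-1)(1-x))^{1/2} − 1 ] dx for s ∈ (0, s_k), and define γ_k(y) = 2 + y k [1 − (1 − 1/k)^{1/2}] − 2[1 − (2y)^{1/2}]^{1/2} − (2y)^{1/2} { 2 − [1 − (2y)^{1/2}]^{1/2} } for y ∈ [0, 1/2]. Then δ_k is differentiable on (0, s_k) and its derivative satisfies δ_k'(s) = [ (k-1)(1-s)/2 ]^{1/2}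 · γ_k( 1/(k(1-s)) ) for all s ∈ (0, s_k). -/
open MeasureTheory intervalIntegral

/-- The residual-difference function `δ_k` in the conservative regime, where the
threshold is `s + (2(1-s)/k)^{1/2}` (no truncation). -/
noncomputable def deltaCons (k : ℕ) (s : ℝ) : ℝ :=
  Real.sqrt (2 * k * (1 - s)) - Real.sqrt (2 * ((k:ℝ) - 1) * (1 - s)) +
    ∫ x in s..(s + Real.sqrt (2 * (1 - s) / k)),
      (Real.sqrt (2 * ((k:ℝ) - 1) * (1 - s)) - Real.sqrt (2 * ((k:ℝ) - 1) * (1 - x)) - 1)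

/-- The function `γ_k` on `[0, 1/2]`. -/
noncomputable def gammaFn (k : ℕ) (y : ℝ) : ℝ :=
  2 + y * k * (1 - Real.sqrt (1 - 1/(k:ℝ)))
    - 2 * Real.sqrt (1 - Real.sqrt (2*y))
    - Real.sqrt (2*y) * (2 - Real.sqrt (1 - Real.sqrt (2*y)))

/-- `deltaCons` with the integral split into its constant part and the increment of a
primitive of `x ↦ √(2(k-1)(1-x))`. -/
lemma deltaCons_eq (k : ℕ) (s : ℝ) :
    deltaCons k s = √(2 * k * (1 - s)) - √(2 * ((k:ℝ) - 1) * (1 - s)) +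
      ((√(2 * ((k:ℝ) - 1) * (1 - s)) - 1) * √(2 * (1 - s) / k) -
        ((∫ x in (0:ℝ)..(s + √(2 * (1 - s) / k)), √(2 * ((k:ℝ) - 1) * (1 - x))) -
          ∫ x in (0:ℝ)..s, √(2 * ((k:ℝ) - 1) * (1 - x)))) := by
  have hg : Continuous fun x : ℝ => √(2 * ((k:ℝ) - 1) * (1 - x)) := by fun_prop
  have hsplit : ∀ x : ℝ, √(2 * ((k:ℝ) - 1) * (1 - s)) - √(2 * ((k:ℝ) - 1) * (1 - x)) - 1 =
      (√(2 * ((k:ℝ) - 1) * (1 - s)) - 1) - √(2 * ((k:ℝ) - 1) * (1 - x)) := fun x => by ring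
  rw [integral_interval_sub_left (hg.intervalIntegrable _ _) (hg.intervalIntegrable _ _)]
  simp only [deltaCons, hsplit]
  rw [integral_sub intervalIntegrable_const (hg.intervalIntegrable _ _),
    intervalIntegral.integral_const, smul_eq_mul]
  ring

/-- The derivative of `√(c (1 - x))`. -/
lemma hasDerivAt_sqrt_mul_one_sub (c s : ℝ) (h : c * (1 - s) ≠ 0) :
    HasDerivAt (fun x : ℝ => √(c * (1 - x))) (-c / (2 * √(c * (1 - s)))) s := by
  have := (((hasDerivAt_id s).const_sub 1).const_mul c).sqrt h
  simpa using this

/-- for `k ≥ 3` and `s ∈ (0, s_k)` with `s_k = 1 − 2/k`, the function `δ_k`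
is differentiable at `s` with derivative `((k-1)(1-s)/2)^{1/2} γ_k(1/(k(1-s)))`. -/
theorem stmt_12 (k : ℕ) (hk : 3 ≤ k) (s : ℝ) (hs : s ∈ Set.Ioo (0:ℝ) (1 - 2/(k:ℝ))) :
    HasDerivAt (deltaCons k)
      (Real.sqrt (((k:ℝ) - 1) * (1 - s) / 2) * gammaFn k (1 / ((k:ℝ) * (1 - s)))) s := by
  obtain ⟨-, hs1⟩ := hs
  have hk3 : (3:ℝ) ≤ k := by exact_mod_cast hk
  have hk0 : (0:ℝ) < k := by linarith
  have ha0 : (0:ℝ) < (k:ℝ) - 1 := by linarith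
  have hu0 : 0 < 1 - s := by
    have : 0 < 2 / (k:ℝ) := by positivity
    linarith
  have hg : Continuous fun x : ℝ => √(2 * ((k:ℝ) - 1) * (1 - x)) := by fun_prop
  have hG : ∀ t : ℝ, HasDerivAt (fun t => ∫ x in (0:ℝ)..t, √(2 * ((k:ℝ) - 1) * (1 - x)))
      √(2 * ((k:ℝ) - 1) * (1 - t)) t := fun t => hg.integral_hasStrictDerivAt 0 t |>.hasDerivAt
  have hp := hasDerivAt_sqrt_mul_one_sub (2 * k) s (by positivity)
  have hq := hasDerivAt_sqrt_mul_one_sub (2 * ((k:ℝ) - 1)) s (by positivity)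
  have hh : HasDerivAt (fun x : ℝ => √(2 * (1 - x) / k))
      (-(2 / k) / (2 * √(2 * (1 - s) / k))) s := by
    have := hasDerivAt_sqrt_mul_one_sub (2 / (k:ℝ)) s (by positivity)
    simpa only [div_mul_eq_mul_div] using this
  have hcomp := (hG (s + √(2 * (1 - s) / k))).comp s ((hasDerivAt_id s).add hh)
  have key := (hp.sub hq).add (((hq.sub_const 1).mul hh).sub (hcomp.sub (hG s)))
  rw [show deltaCons k = _ from funext (deltaCons_eq k)]
  refine key.congr_deriv ?_
  have ep : √(2 * k * (1 - s)) = √2 * √k * √(1 - s) := by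
    rw [Real.sqrt_mul (by positivity), Real.sqrt_mul (by positivity)]
  have eq : √(2 * ((k:ℝ) - 1) * (1 - s)) = √2 * √((k:ℝ) - 1) * √(1 - s) := by
    rw [Real.sqrt_mul (by positivity), Real.sqrt_mul (by positivity)]
  have eh : √(2 * (1 - s) / k) = √2 * √(1 - s) / √k := by
    rw [Real.sqrt_div (by positivity), Real.sqrt_mul (by positivity)]
  have er : √(2 * (1 / (k * (1 - s)))) = √2 / (√k * √(1 - s)) := by
    rw [mul_one_div, Real.sqrt_div (by positivity), Real.sqrt_mul (by positivity)]
  have ea : √(1 - 1 / (k:ℝ)) = √((k:ℝ) - 1) / √k := by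
    rw [← Real.sqrt_div (by positivity)]
    congr 1
    field_simp
  have eA : √(((k:ℝ) - 1) * (1 - s) / 2) = √((k:ℝ) - 1) * √(1 - s) / √2 := by
    rw [Real.sqrt_div (by positivity), Real.sqrt_mul (by positivity)]
  have ht : √(2:ℝ) ^ 2 = 2 := Real.sq_sqrt (by norm_num)
  have hK : √(k:ℝ) ^ 2 = k := Real.sq_sqrt hk0.le
  have hα : √((k:ℝ) - 1) ^ 2 = k - 1 := Real.sq_sqrt ha0.le
  have hc : √(1 - s) ^ 2 = 1 - s := Real.sq_sqrt hu0.le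
  have ew : √(2 * ((k:ℝ) - 1) * (1 - (s + √2 * √(1 - s) / √k))) =
      √2 * √((k:ℝ) - 1) * √(1 - s) * √(1 - √2 / (√k * √(1 - s))) := by
    rw [← eq, ← Real.sqrt_mul (x := 2 * ((k:ℝ) - 1) * (1 - s)) (by positivity)]
    congr 1
    have : (1 - s) * (√2 / (√k * √(1 - s))) = √2 * √(1 - s) / √k := by
      field_simp
      exact hc.symm
    linear_combination 2 * ((k:ℝ) - 1) * this
  have hpt : 0 < √(2:ℝ) := by positivity
  have hpK : 0 < √(k:ℝ) := by positivity
  have hpα : 0 < √((k:ℝ) - 1) := by positivity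
  have hpc : 0 < √(1 - s) := by positivity
  simp only [gammaFn, ep, eq, eh, er, ea, eA, ew]
  generalize √(1 - √2 / (√k * √(1 - s))) = w
  generalize √(2:ℝ) = t at *
  generalize √(k:ℝ) = K at *
  generalize √((k:ℝ) - 1) = α at *
  generalize √(1 - s) = c at *
  rw [← hα, ← hc, ← hK]
  have hαK : α ^ 2 = K ^ 2 - 1 := by rw [hα, hK]
  field_simp
  linear_combination hαK + K * α * c ^ 2 * (1 - w) * ht
end

section
/- Fix an integer k ≥ 1 and define γ_k(y) = 2 + y k [1 − (1 − 1/k)^{1/2}] − 2[1 − (2y)^{1/2}]^{1/2} − (2y)^{1/2} { 2 − [1 − (2y)^{1/2}]^{1/2} } for y ∈ [0, 1/2]. Then γ_k(y) ≥ 0 for all y ∈ [0, 1/2]. -/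
/-- Since `√(1 - x) ≤ 1 - x / 2`, the coefficient of `y` is at least `1 / 2`. -/
theorem half_le_mul_one_sub_sqrt (k : ℕ) (hk : 1 ≤ k) :
    1 / 2 ≤ (k : ℝ) * (1 - Real.sqrt (1 - 1 / (k : ℝ))) := by
  have hk' : (1 : ℝ) ≤ k := by exact_mod_cast hk
  have hx : 1 / (k : ℝ) ≤ 1 := by
    rw [div_le_one (by linarith)]
    exact hk'
  have hs : Real.sqrt (1 - 1 / (k : ℝ)) ≤ 1 - 1 / (k : ℝ) / 2 := by
    rw [Real.sqrt_le_left (by linarith)]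
    nlinarith [sq_nonneg (1 / (k : ℝ))]
  calc (1 : ℝ) / 2 = k * (1 / (k : ℝ) / 2) := by field_simp
    _ ≤ _ := by gcongr; linarith

/-- the function `γ_k` is non-negative on `[0, 1/2]`. -/
theorem stmt_13 (k : ℕ) (hk : 1 ≤ k) (y : ℝ) (hy : y ∈ Set.Icc (0:ℝ) (1/2)) :
    0 ≤ 2 + y * k * (1 - Real.sqrt (1 - 1/(k:ℝ)))
        - 2 * Real.sqrt (1 - Real.sqrt (2*y))
        - Real.sqrt (2*y) * (2 - Real.sqrt (1 - Real.sqrt (2*y))) := by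
  obtain ⟨hy0, hy1⟩ := hy
  have hc := mul_le_mul_of_nonneg_left (half_le_mul_one_sub_sqrt k hk) hy0
  have hs1 : Real.sqrt (2 * y) ≤ 1 := by
    rw [Real.sqrt_le_one]
    linarith
  have hs2 : Real.sqrt (2 * y) ^ 2 = 2 * y := Real.sq_sqrt (by linarith)
  have ht2 : Real.sqrt (1 - Real.sqrt (2 * y)) ^ 2 = 1 - Real.sqrt (2 * y) :=
    Real.sq_sqrt (by linarith)
  set s := Real.sqrt (2 * y)
  set t := Real.sqrt (1 - s)
  have hs : s = 1 - t ^ 2 := by linarith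
  have hyt : y = (1 - t ^ 2) ^ 2 / 2 := by rw [← hs]; linarith
  have key : 2 + y / 2 - 2 * t - s * (2 - t) = (1 - t) ^ 4 / 4 := by
    rw [hyt, hs]
    ring
  have hpos : 0 ≤ (1 - t) ^ 4 / 4 := by positivity
  rw [mul_assoc]
  linarith
end

section
/- For all y ∈ [0, 1/2], one has the inequality (2y)^{1/2} { 2 − [1 − (2y)^{1/2}]^{1/2} } ≤ 2 + y/2 − 2[1 − (2y)^{1/2}]^{1/2}. -/
/-- For all `y ∈ [0, 1/2]`,
`(2y)^{1/2} (2 − (1 − (2y)^{1/2})^{1/2}) ≤ 2 + y/2 − 2 (1 − (2y)^{1/2})^{1/2}`. -/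
theorem stmt_14 (y : ℝ) (hy : y ∈ Set.Icc (0:ℝ) (1/2)) :
    Real.sqrt (2*y) * (2 - Real.sqrt (1 - Real.sqrt (2*y))) ≤
      2 + y/2 - 2 * Real.sqrt (1 - Real.sqrt (2*y)) := by
  obtain ⟨hy0, hy1⟩ := hy
  have ht : Real.sqrt (2*y) ≤ 1 := Real.sqrt_le_one.mpr (by linarith)
  have hty : Real.sqrt (2*y) ^ 2 = 2 * y := Real.sq_sqrt (by linarith)
  have hst : Real.sqrt (1 - Real.sqrt (2*y)) ^ 2 = 1 - Real.sqrt (2*y) :=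
    Real.sq_sqrt (by linarith)
  set t := Real.sqrt (2*y)
  set s := Real.sqrt (1 - t)
  have hts : t = 1 - s ^ 2 := by linarith
  have hys : y = (1 - s ^ 2) ^ 2 / 2 := by rw [← hts]; linarith
  -- The difference of the two sides equals `(1 - s) ^ 4 / 4`.
  have key : 2 + y / 2 - 2 * s - t * (2 - s) = ((1 - s) ^ 2) ^ 2 / 4 := by
    rw [hts, hys]; ring
  linarith [sq_nonneg ((1 - s) ^ 2)]
end
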